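/- arXiv:2112.08188 — 2 statements merged into one kernel-verified Lean document; each statement's English description precedes it below -/
import Mathlib

section
/- Let G be a finite cut group which possesses a nilpotent normal subgroup N such that the quotient G/N is abelian. Then the set of primes dividing the order of G is contained in {2,3,5} or contained in {2,3,7}. -/
/-- An element `g` of a group is *rational* if `g ^ k` is conjugate to `g`
for every integer `k` coprime to the order of `g`. -/
def IsRationalElement {G : Type*} [Group G] (g : G) : Prop :=
  ∀ k : ℤ, Int.gcd k (orderOf g) = 1 → IsConj (g ^ k) g

/-- An element `g` of a group is *inverse semi-rational* if `g ^ k` is conjugate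
to `g` or to `g⁻¹` for every integer `k` coprime to the order of `g`. -/
def IsInverseSemiRationalElement {G : Type*} [Group G] (g : G) : Prop :=
  ∀ k : ℤ, Int.gcd k (orderOf g) = 1 → IsConj (g ^ k) g ∨ IsConj (g ^ k) g⁻¹

/-- A group is a *cut group* if every element is inverse semi-rational. -/
def IsCutGroup (G : Type*) [Group G] : Prop :=
  ∀ g : G, IsInverseSemiRationalElement g

/-- A group is *rational* if every element is rational. -/
def IsRationalGroup (G : Type*) [Group G] : Prop :=
  ∀ g : G, IsRationalElement g

/-- A nontrivial normal subgroup of a nilpotent group meets the center nontrivially. -/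
theorem Subgroup.Normal.exists_mem_center_of_isNilpotent {N : Type*} [Group N]
    (hnil : Group.IsNilpotent N) (P : Subgroup N) (hP : P.Normal) (hbot : P ≠ ⊥) :
    ∃ x ∈ P, x ≠ 1 ∧ x ∈ Subgroup.center N := by
  classical
  obtain ⟨y, hyP, hy1⟩ := P.bot_or_exists_ne_one.resolve_left hbot
  obtain ⟨n, hn⟩ := hnil.nilpotent
  have hex : ∃ i, ∃ x ∈ P, x ≠ 1 ∧ x ∈ Subgroup.upperCentralSeries N i :=
    ⟨n, y, hyP, hy1, by rw [hn]; trivial⟩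
  obtain ⟨x, hxP, hx1, hx⟩ := Nat.find_spec hex
  rcases hi : Nat.find hex with _ | j
  · rw [hi] at hx
    exact absurd (by simpa using hx) hx1
  · rw [hi] at hx
    refine ⟨x, hxP, hx1, Subgroup.mem_center_iff.2 fun g => ?_⟩
    have hcomm := (Subgroup.mem_upperCentralSeries_succ_iff.1 hx) g
    have hmemP : x * g * x⁻¹ * g⁻¹ ∈ P := by
      have := P.mul_mem hxP (hP.conj_mem _ (P.inv_mem hxP) g)
      simpa [mul_assoc] using this
    have hone : x * g * x⁻¹ * g⁻¹ = 1 := by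
      by_contra hne
      exact Nat.find_min hex (m := j) (by omega) ⟨_, hmemP, hne, by simpa [commutatorElement_def] using hcomm⟩
    rw [mul_inv_eq_one, mul_inv_eq_iff_eq_mul] at hone
    exact hone.symm

/-- The center of a finite nilpotent group has an element of every prime order dividing the
order of the group. -/
theorem Group.IsNilpotent.exists_mem_center_orderOf_eq {N : Type*} [Group N] [Finite N]
    (hnil : Group.IsNilpotent N) {p : ℕ} (hp : p.Prime) (hdvd : p ∣ Nat.card N) :
    ∃ x ∈ Subgroup.center N, orderOf x = p := by
  have := Fact.mk hp
  let P : Sylow p N := default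
  obtain ⟨x, hxP, hx1, hxc⟩ := Subgroup.Normal.exists_mem_center_of_isNilpotent hnil
    (P : Subgroup N) inferInstance (P.ne_bot_of_dvd_card hdvd)
  obtain ⟨k, hk⟩ := IsPGroup.iff_orderOf.1 P.isPGroup' ⟨x, hxP⟩
  rw [Subgroup.orderOf_mk] at hk
  have hpx : p ∣ orderOf x := by
    rw [hk]
    refine dvd_pow_self p fun h0 => hx1 ?_
    rw [← orderOf_eq_one_iff, hk, h0, pow_zero]
  exact ⟨x ^ (orderOf x / p), Subgroup.pow_mem _ hxc _,
    orderOf_pow_orderOf_div (orderOf_pos x).ne' hpx⟩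

/-- A surjective image of a finite cut group is a cut group. -/
theorem IsCutGroup.of_surjective {G Q : Type*} [Group G] [Finite G] [Group Q]
    (hcut : IsCutGroup G) (f : G →* Q) (hf : Function.Surjective f) : IsCutGroup Q := by
  intro q k hk
  obtain ⟨g, rfl⟩ := hf q
  have hpos : NeZero (orderOf g) := ⟨(orderOf_pos g).ne'⟩
  have hd : orderOf (f g) ∣ orderOf g := orderOf_map_dvd f g
  obtain ⟨v, hv⟩ := ZMod.unitsMap_surjective hd
    (ZMod.unitOfIsCoprime k (Int.isCoprime_iff_gcd_eq_one.2 hk))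
  obtain ⟨m, hm⟩ := ZMod.intCast_surjective (v : ZMod (orderOf g))
  have hmcop : Int.gcd m (orderOf g) = 1 := by
    rw [← Int.isCoprime_iff_gcd_eq_one, isCoprime_comm, ← ZMod.coe_int_isUnit_iff_isCoprime, hm]
    exact v.isUnit
  have hmk : f g ^ m = f g ^ k := by
    rw [zpow_eq_zpow_iff_modEq, ← ZMod.intCast_eq_intCast_iff]
    have := congrArg Units.val hv
    simpa [ZMod.unitsMap_def, ← hm] using this
  rw [← hmk, ← map_zpow, ← map_inv]
  exact (hcut g m hmcop).imp f.map_isConj f.map_isConj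

/-- In an abelian cut group, every element has order dividing `4` or `6`. -/
theorem IsCutGroup.pow_four_or_pow_six_eq_one {Q : Type*} [CommGroup Q] [Finite Q]
    (hcut : IsCutGroup Q) (q : Q) : q ^ 4 = 1 ∨ q ^ 6 = 1 := by
  have key (r : Q) (k : ℕ) (hk : Nat.Coprime (k + 1) (orderOf r)) :
      orderOf r ∣ k ∨ orderOf r ∣ k + 2 := by
    refine (hcut r ((k + 1 : ℕ) : ℤ) hk).imp (fun h => ?_) (fun h => ?_)
    · rw [isConj_iff_eq, zpow_natCast, pow_succ, mul_eq_right] at h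
      exact orderOf_dvd_of_pow_eq_one h
    · rw [isConj_iff_eq, zpow_natCast, eq_inv_iff_mul_eq_one, ← pow_succ] at h
      exact orderOf_dvd_of_pow_eq_one h
  have h5 : ¬ 5 ∣ orderOf q := fun h => by
    have ho := orderOf_pow_orderOf_div (orderOf_pos q).ne' h
    have := key (q ^ (orderOf q / 5)) 1 (by rw [ho]; decide)
    rw [ho] at this
    omega
  exact (key q 4 ((Nat.Prime.coprime_iff_not_dvd (by norm_num)).2 h5)).imp
    orderOf_dvd_iff_pow_eq_one.1 orderOf_dvd_iff_pow_eq_one.1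

/-- An abelian cut group has exponent dividing `4` or `6`. -/
theorem IsCutGroup.forall_pow_four_or_forall_pow_six {Q : Type*} [CommGroup Q] [Finite Q]
    (hcut : IsCutGroup Q) : (∀ q : Q, q ^ 4 = 1) ∨ ∀ q : Q, q ^ 6 = 1 := by
  by_contra! h
  obtain ⟨⟨a, ha⟩, b, hb⟩ := h
  have ha6 := (hcut.pow_four_or_pow_six_eq_one a).resolve_left ha
  have hb4 := (hcut.pow_four_or_pow_six_eq_one b).resolve_right hb
  rcases hcut.pow_four_or_pow_six_eq_one (a * b) with h | h
  · exact ha (by simpa [mul_pow, hb4] using h)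
  · exact hb (by simpa [mul_pow, ha6] using h)

/-- If `x` has order coprime to `2` in a cut group and the `e`-th power of every element
centralizes `x`, for some even `e`, then the order of `x` divides `2 ^ e - 1`. -/
theorem IsCutGroup.pow_two_pow_eq {G : Type*} [Group G] (hcut : IsCutGroup G) {x : G}
    (hx : Nat.Coprime 2 (orderOf x)) {e : ℕ} (he : Even e)
    (hcomm : ∀ g : G, Commute (g ^ e) x) : x ^ 2 ^ e = x := by
  obtain ⟨ε, hε, h⟩ : ∃ ε : ℤ, ε ^ 2 = 1 ∧ IsConj (x ^ 2) (x ^ ε) := by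
    rcases hcut x 2 hx with h | h
    · exact ⟨1, by norm_num, by simpa using h⟩
    · exact ⟨-1, by norm_num, by simpa using h⟩
  obtain ⟨g, hg⟩ := isConj_iff.1 h.symm
  have hconj : g * x * g⁻¹ = x ^ (2 * ε) := by
    have hεε : x = (x ^ ε) ^ ε := by rw [← zpow_mul, ← sq, hε, zpow_one]
    conv_lhs => rw [hεε]
    rw [← conj_zpow, hg, zpow_mul]
    norm_cast
  have hiter (n : ℕ) : g ^ n * x * (g ^ n)⁻¹ = x ^ ((2 * ε) ^ n) := by
    induction n with
    | zero => simp
    | succ n ih =>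
      calc g ^ (n + 1) * x * (g ^ (n + 1))⁻¹ = g * (g ^ n * x * (g ^ n)⁻¹) * g⁻¹ := by
            rw [pow_succ']; group
        _ = x ^ ((2 * ε) ^ (n + 1)) := by rw [ih, ← conj_zpow, hconj, ← zpow_mul, ← pow_succ']
  have hfix := hiter e
  rw [(hcomm g).eq, mul_inv_cancel_right, mul_pow] at hfix
  obtain ⟨d, rfl⟩ := he.two_dvd
  rw [pow_mul ε, hε, one_pow, mul_one] at hfix
  rw [eq_comm]
  exact_mod_cast hfix

theorem stmt_18 (G : Type*) [Group G] [Finite G] (hcut : IsCutGroup G)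
    (N : Subgroup G) [N.Normal] (hnil : Group.IsNilpotent ↥N)
    (hab : ∀ a b : G ⧸ N, a * b = b * a) :
    (Nat.card G).primeFactors ⊆ {2, 3, 5} ∨ (Nat.card G).primeFactors ⊆ {2, 3, 7} := by
  let _ : CommGroup (G ⧸ N) := { (inferInstance : Group (G ⧸ N)) with mul_comm := hab }
  have hQ : IsCutGroup (G ⧸ N) :=
    hcut.of_surjective (QuotientGroup.mk' N) (QuotientGroup.mk'_surjective N)
  have key (e : ℕ) (he : Even e) (hexp : ∀ q : G ⧸ N, q ^ e = 1) (p : ℕ) (hp : p.Prime)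
      (hpG : p ∣ Nat.card G) : p = 2 ∨ p ∣ e ∨ p ∣ 2 ^ e - 1 := by
    refine or_iff_not_imp_left.2 fun hp2 => ?_
    have := Fact.mk hp
    rw [N.card_eq_card_quotient_mul_card_subgroup, hp.dvd_mul] at hpG
    refine hpG.imp (fun h => ?_) (fun h => ?_)
    · obtain ⟨q, hq⟩ := exists_prime_orderOf_dvd_card' (G := G ⧸ N) p h
      exact hq ▸ orderOf_dvd_of_pow_eq_one (hexp q)
    · obtain ⟨x, hxc, hx⟩ := hnil.exists_mem_center_orderOf_eq hp h
      have hxG : orderOf (x : G) = p := by rw [Subgroup.orderOf_coe, hx]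
      have hfix := hcut.pow_two_pow_eq (x := (x : G))
        (by rw [hxG]; exact (Nat.coprime_primes Nat.prime_two hp).2 (Ne.symm hp2)) he
        fun g => by
          have hg : g ^ e ∈ N := by
            rw [← QuotientGroup.eq_one_iff, QuotientGroup.mk_pow]
            exact hexp g
          exact congrArg Subtype.val (Subgroup.mem_center_iff.1 hxc ⟨g ^ e, hg⟩)
      rw [← hxG]
      refine orderOf_dvd_of_pow_eq_one ?_
      rw [pow_sub _ Nat.one_le_two_pow, hfix, pow_one, mul_inv_cancel]
  refine hQ.forall_pow_four_or_forall_pow_six.imp (fun h p hp => ?_) (fun h p hp => ?_)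
  · have hpp := Nat.prime_of_mem_primeFactors hp
    rcases key 4 (by decide) h p hpp (Nat.dvd_of_mem_primeFactors hp) with h | h | h
    · simp [h]
    · have := Nat.le_of_dvd (by norm_num) h
      interval_cases p <;> revert hpp h <;> decide
    · have := Nat.le_of_dvd (by norm_num) h
      interval_cases p <;> revert hpp h <;> decide
  · have hpp := Nat.prime_of_mem_primeFactors hp
    rcases key 6 (by decide) h p hpp (Nat.dvd_of_mem_primeFactors hp) with h | h | h
    · simp [h]
    · have := Nat.le_of_dvd (by norm_num) h
      interval_cases p <;> revert hpp h <;> decide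
    · have := Nat.le_of_dvd (by norm_num) h
      interval_cases p <;> revert hpp h <;> decide
end

section
/- Let G be a finite cut group which possesses a nilpotent normal subgroup N such that the quotient G/N is abelian. If 15 divides the order of G, then G contains an element of order 15. -/
theorem Group.IsNilpotent.prime_dvd_card_center (p : ℕ) [hp : Fact p.Prime] (G : Type*) [Group G]
    [Group.IsNilpotent G] : Finite G → p ∣ Nat.card G → p ∣ Nat.card (Subgroup.center G) := by
  refine Group.nilpotent_center_quotient_ind
    (P := fun G _ _ => Finite G → p ∣ Nat.card G → p ∣ Nat.card (Subgroup.center G)) G ?_ ?_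
  · intro G _ _ _ hdvd
    rw [Nat.card_unique] at hdvd
    exact absurd hdvd hp.out.not_dvd_one
  · intro G _ _ ih _ hdvd
    by_contra hc
    rw [Subgroup.card_eq_card_quotient_mul_card_subgroup (Subgroup.center G)] at hdvd
    obtain ⟨⟨y, hyc⟩, hy⟩ := exists_prime_orderOf_dvd_card' p
      (ih inferInstance ((hp.out.dvd_mul.mp hdvd).resolve_right hc))
    rw [Subgroup.orderOf_mk] at hy
    obtain ⟨x, rfl⟩ := QuotientGroup.mk_surjective y
    have hxp : x ^ p ∈ Subgroup.center G := by
      rw [← QuotientGroup.eq_one_iff, QuotientGroup.mk_pow, ← hy, pow_orderOf_eq_one]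
    have hx : x ∈ Subgroup.center G := by
      rw [Subgroup.mem_center_iff]
      intro g
      set z := g * x * g⁻¹ * x⁻¹ with hz_def
      have hz : z ∈ Subgroup.center G := by
        rw [← QuotientGroup.eq_one_iff]
        have h := Subgroup.mem_center_iff.mp hyc (g : G ⧸ Subgroup.center G)
        simp only [hz_def, QuotientGroup.mk_mul, QuotientGroup.mk_inv, h]
        group
      have hgx : g * x * g⁻¹ = z * x := by simp [hz_def]
      have hzx : Commute z x := (Subgroup.mem_center_iff.mp hz x).symm
      have hzp : z ^ p = 1 := by
        have h : (g * x * g⁻¹) ^ p = x ^ p := by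
          rw [conj_pow, Subgroup.mem_center_iff.mp hxp g, mul_inv_cancel_right]
        rw [hgx, hzx.mul_pow] at h
        exact mul_eq_right.mp h
      have hz1 : z = 1 := by
        by_contra hne
        have ho : orderOf z = p := orderOf_eq_prime hzp hne
        apply hc
        have h := orderOf_dvd_natCard (⟨z, hz⟩ : Subgroup.center G)
        rwa [Subgroup.orderOf_mk, ho] at h
      rw [hz1, one_mul] at hgx
      exact mul_inv_eq_iff_eq_mul.mp hgx
    rw [(QuotientGroup.eq_one_iff x).mpr hx, orderOf_one] at hy
    exact hp.out.ne_one hy.symm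

/-- Every unit modulo the order of an element of a quotient lifts to a unit modulo the order of a
representative, so abelian quotients of cut groups are cut. -/
theorem IsCutGroup.pow_eq_or_pow_eq_inv_of_quotient {G : Type*} [Group G] [Finite G]
    (hcut : IsCutGroup G) (N : Subgroup G) [N.Normal] (hab : ∀ a b : G ⧸ N, a * b = b * a)
    (b : G ⧸ N) (k : ℕ) (hk : k.Coprime (orderOf b)) : b ^ k = b ∨ b ^ k = b⁻¹ := by
  obtain ⟨g, rfl⟩ := QuotientGroup.mk_surjective b
  have hdvd : orderOf (g : G ⧸ N) ∣ orderOf g := orderOf_map_dvd (QuotientGroup.mk' N) g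
  have : NeZero (orderOf g) := ⟨(orderOf_pos g).ne'⟩
  obtain ⟨u, hu⟩ := ZMod.unitsMap_surjective hdvd (ZMod.unitOfCoprime k hk)
  have hmod : (u : ZMod (orderOf g)).val ≡ k [MOD orderOf (g : G ⧸ N)] := by
    rw [← ZMod.natCast_eq_natCast_iff]
    have h := congrArg Units.val hu
    rw [ZMod.unitsMap_val, ZMod.coe_unitOfCoprime] at h
    rw [← h, ZMod.natCast_val]
  have hpow : (g : G ⧸ N) ^ (u : ZMod (orderOf g)).val = (g : G ⧸ N) ^ k :=
    pow_eq_pow_iff_modEq.mpr hmod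
  have hconj : ∀ a c : G, IsConj a c → (a : G ⧸ N) = c := by
    intro a c h
    obtain ⟨d, hd⟩ := isConj_iff.mp h
    rw [← hd, QuotientGroup.mk_mul, QuotientGroup.mk_mul, hab d a, QuotientGroup.mk_inv,
      mul_inv_cancel_right]
  rw [← hpow]
  refine (hcut g (u : ZMod (orderOf g)).val ?_).imp (fun h => ?_) (fun h => ?_)
  · rw [Int.gcd_natCast_natCast]
    exact ZMod.val_coe_unit_coprime u
  · simpa only [zpow_natCast, QuotientGroup.mk_pow, QuotientGroup.mk_inv] using hconj _ _ h
  · simpa only [zpow_natCast, QuotientGroup.mk_pow, QuotientGroup.mk_inv] using hconj _ _ h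

theorem conj_pow_eq_zpow_pow {G : Type*} [Group G] {g x : G} {u : ℤ} (h : g * x * g⁻¹ = x ^ u)
    (n : ℕ) : g ^ n * x * (g ^ n)⁻¹ = x ^ (u ^ n) := by
  induction n with
  | zero => simp
  | succ n ih =>
    calc g ^ (n + 1) * x * (g ^ (n + 1))⁻¹ = g * (g ^ n * x * (g ^ n)⁻¹) * g⁻¹ := by
          rw [pow_succ']; group
      _ = x ^ (u ^ (n + 1)) := by rw [ih, ← conj_zpow, h, ← zpow_mul, pow_succ']

theorem four_dvd_of_two_or_neg_two_pow_eq_one {u : ℤ} (hu : u = 2 ∨ u = -2) {n : ℕ}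
    (h : (u : ZMod 5) ^ n = 1) : 4 ∣ n := by
  have ho : orderOf (u : ZMod 5) = 2 ^ (1 + 1) := by
    rcases hu with rfl | rfl <;> exact orderOf_eq_prime_pow (by decide) (by decide)
  exact (show (4 : ℕ) = 2 ^ (1 + 1) by norm_num) ▸ ho ▸ orderOf_dvd_of_pow_eq_one h

/-- In a cut group, some element acts on a given subgroup of order five as an automorphism of
order four. -/
theorem IsCutGroup.exists_conj_eq_zpow {G : Type*} [Group G] (hcut : IsCutGroup G) {x : G}
    (hx : orderOf x = 5) : ∃ g : G, ∃ u : ℤ, (u = 2 ∨ u = -2) ∧ g * x * g⁻¹ = x ^ u := by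
  rcases hcut x 2 (by rw [hx]; rfl) with h | h
  · obtain ⟨g, hg⟩ := isConj_iff.mp h.symm
    exact ⟨g, 2, Or.inl rfl, hg⟩
  · obtain ⟨g, hg⟩ := isConj_iff.mp h.symm
    refine ⟨g, -2, Or.inr rfl, ?_⟩
    rw [zpow_neg, ← hg]
    group

theorem stmt_19 (G : Type*) [Group G] [Finite G] (hcut : IsCutGroup G)
    (N : Subgroup G) [N.Normal] (hnil : Group.IsNilpotent ↥N)
    (hab : ∀ a b : G ⧸ N, a * b = b * a)
    (h15 : 15 ∣ Nat.card G) :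
    ∃ g : G, orderOf g = 15 := by
  have : Fact (Nat.Prime 5) := ⟨by norm_num⟩
  have : Fact (Nat.Prime 3) := ⟨by norm_num⟩
  have hsemi := hcut.pow_eq_or_pow_eq_inv_of_quotient N hab
  have hcard := Subgroup.card_eq_card_quotient_mul_card_subgroup N
  have h5N : 5 ∣ Nat.card N := by
    have h5 : 5 ∣ Nat.card G := dvd_trans (by norm_num) h15
    rw [hcard] at h5
    refine ((Nat.Prime.dvd_mul (by norm_num)).mp h5).resolve_left fun h => ?_
    obtain ⟨b, hb⟩ := exists_prime_orderOf_dvd_card' 5 h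
    rcases hsemi b 2 (by rw [hb]; norm_num) with h2 | h2
    · have : b ^ 1 = 1 := by rw [pow_one]; rwa [pow_two, mul_eq_left] at h2
      exact absurd (orderOf_dvd_of_pow_eq_one this) (by rw [hb]; norm_num)
    · have : b ^ 3 = 1 := by rw [pow_succ, h2, inv_mul_cancel]
      exact absurd (orderOf_dvd_of_pow_eq_one this) (by rw [hb]; norm_num)
  obtain ⟨⟨x, hxc⟩, hx⟩ := exists_prime_orderOf_dvd_card' 5
    (Group.IsNilpotent.prime_dvd_card_center 5 N inferInstance h5N)
  rw [Subgroup.orderOf_mk] at hx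
  have hxcomm : ∀ y : N, y * x = x * y := Subgroup.mem_center_iff.mp hxc
  have hxG : orderOf (x : G) = 5 := by rw [Subgroup.orderOf_coe, hx]
  have h3 : 3 ∣ Nat.card G := dvd_trans (by norm_num) h15
  rw [hcard] at h3
  rcases (Nat.Prime.dvd_mul (by norm_num)).mp h3 with h3 | h3
  · exfalso
    obtain ⟨a, ha⟩ := exists_prime_orderOf_dvd_card' 3 h3
    obtain ⟨g, u, hu, hg⟩ := hcut.exists_conj_eq_zpow hxG
    have h4 : 4 ∣ orderOf (g : G ⧸ N) := by
      have hmem : g ^ orderOf (g : G ⧸ N) ∈ N := by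
        rw [← QuotientGroup.eq_one_iff, QuotientGroup.mk_pow, pow_orderOf_eq_one]
      have h := conj_pow_eq_zpow_pow hg (orderOf (g : G ⧸ N))
      have hcomm : g ^ orderOf (g : G ⧸ N) * (x : G) = x * g ^ orderOf (g : G ⧸ N) :=
        congrArg Subtype.val (hxcomm ⟨_, hmem⟩)
      rw [hcomm, mul_inv_cancel_right] at h
      have h' : (x : G) ^ (u ^ orderOf (g : G ⧸ N) - 1) = 1 := by
        rw [zpow_sub, ← h, zpow_one, mul_inv_cancel]
      rw [← orderOf_dvd_iff_zpow_eq_one, hxG] at h'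
      have hz := (ZMod.intCast_zmod_eq_zero_iff_dvd _ 5).mpr h'
      push_cast at hz
      exact four_dvd_of_two_or_neg_two_pow_eq_one hu (sub_eq_zero.mp hz)
    set c := (g : G ⧸ N) ^ (orderOf (g : G ⧸ N) / 4)
    have hc : orderOf c = 4 := orderOf_pow_orderOf_div (orderOf_pos _).ne' h4
    have hac : orderOf (a * c) = 12 := by
      rw [Commute.orderOf_mul_eq_mul_orderOf_of_coprime (hab a c) (by rw [ha, hc]; norm_num),
        ha, hc]
    rcases hsemi (a * c) 5 (by rw [hac]; norm_num) with h | h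
    · have : (a * c) ^ 4 = 1 := by rwa [pow_succ, mul_eq_right] at h
      exact absurd (orderOf_dvd_of_pow_eq_one this) (by rw [hac]; norm_num)
    · have : (a * c) ^ 6 = 1 := by rw [pow_succ, h, inv_mul_cancel]
      exact absurd (orderOf_dvd_of_pow_eq_one this) (by rw [hac]; norm_num)
  · obtain ⟨y, hy⟩ := exists_prime_orderOf_dvd_card' 3 h3
    refine ⟨((y * x : N) : G), ?_⟩
    rw [Subgroup.orderOf_coe,
      Commute.orderOf_mul_eq_mul_orderOf_of_coprime (hxcomm y) (by rw [hy, hx]; norm_num), hy, hx]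
end
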